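/- Let f be an expanding Lorenz map with critical point c admitting a primary n(k)-cycle z_0 < z_1 < ⋯ < z_{n-k-1} < c < z_{n-k} < ⋯ < z_{n-1}. If g̃ = (f^l, f^r) is any renormalization of f such that l ≥ n or r ≥ n, then n divides l and n divides r. -/

import Mathlib

open Set Filter Topology Function

/-- `f` is an expanding Lorenz map on `[a,b]` with critical point `c`:
continuous and strictly increasing on `[a,c)` and `(c,b]`, with
`lim_{x→c⁻} f(x) = b`, `lim_{x→c⁺} f(x) = a`, and differentiable with
derivative uniformly greater than `1` outside a finite set. -/
structure IsExpandingLorenzOn (f : ℝ → ℝ) (c a b : ℝ) : Prop where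
  a_lt_c : a < c
  c_lt_b : c < b
  mapsTo : Set.MapsTo f (Set.Icc a b) (Set.Icc a b)
  mono_left : StrictMonoOn f (Set.Ico a c)
  mono_right : StrictMonoOn f (Set.Ioc c b)
  cont_left : ContinuousOn f (Set.Ico a c)
  cont_right : ContinuousOn f (Set.Ioc c b)
  lim_left : Filter.Tendsto f (nhdsWithin c (Set.Iio c)) (nhds b)
  lim_right : Filter.Tendsto f (nhdsWithin c (Set.Ioi c)) (nhds a)
  expanding : ∃ F : Set ℝ, F.Finite ∧ ∃ lam : ℝ, 1 < lam ∧
    ∀ x ∈ Set.Icc a b \ F, ∃ d : ℝ, HasDerivWithinAt f d (Set.Icc a b) x ∧ lam ≤ d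

/-- An expanding Lorenz map on `[0,1]` with critical point `c`. -/
def IsExpandingLorenz (f : ℝ → ℝ) (c : ℝ) : Prop := IsExpandingLorenzOn f c 0 1

/-- A primary `n(k)`-cycle `z 0 < z 1 < ⋯ < z (n-k-1) < c < z (n-k) < ⋯ < z (n-1)`
for a Lorenz map `f` with critical point `c`. -/
structure IsPrimaryCycle (f : ℝ → ℝ) (c : ℝ) (n k : ℕ) (z : ℕ → ℝ) : Prop where
  k_pos : 0 < k
  k_lt_n : k < n
  coprime : Nat.Coprime n k
  mem : ∀ i < n, z i ∈ Set.Icc (0:ℝ) 1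
  mono : ∀ i j : ℕ, i < j → j < n → z i < z j
  left_of_c : ∀ i < n - k, z i < c
  right_of_c : ∀ i : ℕ, n - k ≤ i → i < n → c < z i
  step : ∀ i < n, f (z i) = z ((i + k) % n)
  le_f0 : z (k - 1) ≤ f 0
  f1_le : f 1 ≤ z k

/-- `g` is a renormalization `(f^l, f^r)` of the Lorenz map `f` on the
renormalization interval `[u,v]`: on `[u,c)` (resp. `(c,v]`) the map `g`
is given by `f^[l]` (resp. `f^[r]`), with values given by one-sided limits
at points where some earlier iterate hits `c`, and `g` is itself an
expanding Lorenz map on `[u,v]` with critical point `c`. -/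
structure IsRenormalization (f : ℝ → ℝ) (c : ℝ) (l r : ℕ) (u v : ℝ) (g : ℝ → ℝ) : Prop where
  one_lt_l : 1 < l
  one_lt_r : 1 < r
  u_nonneg : 0 ≤ u
  u_lt_c : u < c
  c_lt_v : c < v
  v_le_one : v ≤ 1
  proper : 0 < u ∨ v < 1
  eq_left : ∀ x ∈ Set.Ico u c, (∀ i < l, f^[i] x ≠ c) → g x = f^[l] x
  eq_right : ∀ x ∈ Set.Ioc c v, (∀ i < r, f^[i] x ≠ c) → g x = f^[r] x
  lim_left_pt : ∀ x ∈ Set.Ico u c,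
    Filter.Tendsto (f^[l]) (nhdsWithin x (Set.Ioi x)) (nhds (g x))
  lim_right_pt : ∀ x ∈ Set.Ioc c v,
    Filter.Tendsto (f^[r]) (nhdsWithin x (Set.Iio x)) (nhds (g x))
  lim_c_left : Filter.Tendsto (f^[l]) (nhdsWithin c (Set.Iio c)) (nhds v)
  lim_c_right : Filter.Tendsto (f^[r]) (nhdsWithin c (Set.Ioi c)) (nhds u)
  lorenz : IsExpandingLorenzOn g c u v

/-- The forward orbit of `x` enters the set `S` with a `c`-free prefix:
there is `n ≥ 0` with `f^[i] x ≠ c` for `0 ≤ i < n` and `f^[n] x ∈ S`. -/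
def CFreeEnters (f : ℝ → ℝ) (c : ℝ) (S : Set ℝ) (x : ℝ) : Prop :=
  ∃ n : ℕ, (∀ i < n, f^[i] x ≠ c) ∧ f^[n] x ∈ S

/-- `N(U) = min {n ≥ 0 : f^[n] z = c for some z ∈ U}`. -/
noncomputable def hitTime (f : ℝ → ℝ) (c : ℝ) (U : Set ℝ) : ℕ :=
  sInf {n : ℕ | ∃ z ∈ U, f^[n] z = c}

/-- `x ∈ [0,1]` is a `c`-free periodic point of `f` of (exact) period `p`. -/
def IsCFreePeriodic (f : ℝ → ℝ) (c x : ℝ) (p : ℕ) : Prop :=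
  x ∈ Set.Icc (0:ℝ) 1 ∧ f^[p] x = x ∧ (∀ i : ℕ, 0 < i → i < p → f^[i] x ≠ x) ∧
    ∀ i < p, f^[i] x ≠ c

/-- Topological transitivity of `f` as a map of `[0,1]`. -/
def LorenzTransitive (f : ℝ → ℝ) : Prop :=
  ∀ U V : Set ℝ, IsOpen U → IsOpen V →
    (U ∩ Set.Icc 0 1).Nonempty → (V ∩ Set.Icc 0 1).Nonempty →
    ∃ n : ℕ, (f^[n] '' (U ∩ Set.Icc 0 1) ∩ (V ∩ Set.Icc 0 1)).Nonempty

/-- `f` is locally eventually onto: every nonempty (relatively) open subset of `[0,1]`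
contains open intervals mapped homeomorphically onto `(0,c)` and onto `(c,1)`
by suitable iterates of `f`. -/
def LocallyEventuallyOnto (f : ℝ → ℝ) (c : ℝ) : Prop :=
  ∀ U : Set ℝ, IsOpen U → (U ∩ Set.Icc 0 1).Nonempty →
    (∃ a b : ℝ, a < b ∧ Set.Ioo a b ⊆ U ∩ Set.Icc 0 1 ∧ ∃ n : ℕ,
      ContinuousOn (f^[n]) (Set.Ioo a b) ∧ Set.InjOn (f^[n]) (Set.Ioo a b) ∧
        f^[n] '' Set.Ioo a b = Set.Ioo 0 c) ∧
    (∃ a b : ℝ, a < b ∧ Set.Ioo a b ⊆ U ∩ Set.Icc 0 1 ∧ ∃ n : ℕ,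
      ContinuousOn (f^[n]) (Set.Ioo a b) ∧ Set.InjOn (f^[n]) (Set.Ioo a b) ∧
        f^[n] '' Set.Ioo a b = Set.Ioo c 1)

/-- The generalized backward orbit of `x`: points joined to `x` by a chain
following `f`, where at the critical point `c` the chain may continue with
either `0` or `1`. -/
def GenBackwardOrbit (f : ℝ → ℝ) (c x : ℝ) : Set ℝ :=
  {y | y ∈ Set.Icc (0:ℝ) 1 ∧ ∃ (k : ℕ) (w : ℕ → ℝ), w 0 = y ∧ w k = x ∧
    ∀ i < k, (w i ≠ c → w (i + 1) = f (w i)) ∧ (w i = c → w (i + 1) = 0 ∨ w (i + 1) = 1)}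
section Expansion

theorem le_sub_of_hasDerivAt_off_finite {f : ℝ → ℝ} {lam : ℝ} (F : Finset ℝ) :
    ∀ {a b : ℝ}, a ≤ b → ContinuousOn f (Icc a b) →
      (∀ x ∈ Ioo a b, x ∉ F → ∃ d, HasDerivAt f d x ∧ lam ≤ d) →
      lam * (b - a) ≤ f b - f a := by
  induction F using Finset.induction_on with
  | empty =>
    intro a b hab hc hd
    refine (convex_Icc a b).mul_sub_le_image_sub_of_le_deriv hc ?_ ?_ a
      (left_mem_Icc.2 hab) b (right_mem_Icc.2 hab) hab
    · intro x hx
      rw [interior_Icc] at hx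
      obtain ⟨d, h, -⟩ := hd x hx (by simp)
      exact h.differentiableAt.differentiableWithinAt
    · intro x hx
      rw [interior_Icc] at hx
      obtain ⟨d, h, hl⟩ := hd x hx (by simp)
      rwa [h.deriv]
  | insert p F _ ih =>
    intro a b hab hc hd
    by_cases hp : p ∈ Ioo a b
    · have h1 := ih hp.1.le (hc.mono (Icc_subset_Icc_right hp.2.le)) fun x hx hF =>
        hd x ⟨hx.1, hx.2.trans hp.2⟩ (by simp [hF, hx.2.ne])
      have h2 := ih hp.2.le (hc.mono (Icc_subset_Icc_left hp.1.le)) fun x hx hF =>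
        hd x ⟨hp.1.trans hx.1, hx.2⟩ (by simp [hF, hx.1.ne'])
      linarith
    · refine ih hab hc fun x hx hF => hd x hx ?_
      simp only [Finset.mem_insert, not_or]
      exact ⟨fun h => hp (h ▸ hx), hF⟩

namespace IsExpandingLorenzOn

variable {f : ℝ → ℝ} {c a b : ℝ}

theorem exists_expansion (hf : IsExpandingLorenzOn f c a b) :
    ∃ lam : ℝ, 1 < lam ∧ ∀ x y, x ≤ y → (x ∈ Ico a c ∧ y ∈ Ico a c ∨ x ∈ Ioc c b ∧ y ∈ Ioc c b) →
      lam * (y - x) ≤ f y - f x := by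
  obtain ⟨F, hF, lam, hlam, hd⟩ := hf.expanding
  refine ⟨lam, hlam, fun x y hxy h => ?_⟩
  have hac := hf.a_lt_c
  have hcb := hf.c_lt_b
  have hax : a ≤ x := by rcases h with ⟨h, -⟩ | ⟨h, -⟩ <;> linarith [h.1]
  have hyb : y ≤ b := by rcases h with ⟨-, h⟩ | ⟨-, h⟩ <;> linarith [h.2]
  refine le_sub_of_hasDerivAt_off_finite hF.toFinset hxy ?_ ?_
  · rcases h with ⟨hx, hy⟩ | ⟨hx, hy⟩
    · exact hf.cont_left.mono fun w hw => ⟨hx.1.trans hw.1, hw.2.trans_lt hy.2⟩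
    · exact hf.cont_right.mono fun w hw => ⟨hx.1.trans_le hw.1, hw.2.trans hy.2⟩
  · intro w hw hwF
    rw [Set.Finite.mem_toFinset] at hwF
    obtain ⟨d, h1, h2⟩ := hd w ⟨⟨hax.trans hw.1.le, hw.2.le.trans hyb⟩, hwF⟩
    exact ⟨d, h1.hasDerivAt (Icc_mem_nhds (hax.trans_lt hw.1) (hw.2.trans_le hyb)), h2⟩

theorem lt_right (hf : IsExpandingLorenzOn f c a b) {x : ℝ} (hx : x ∈ Ico a c) : f x < b := by
  obtain ⟨y, hxy, hyc⟩ := exists_between hx.2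
  have hy : y ∈ Ico a c := ⟨hx.1.trans hxy.le, hyc⟩
  refine (hf.mono_left hx hy hxy).trans_le (hf.mapsTo ⟨hy.1, ?_⟩).2
  exact hyc.le.trans hf.c_lt_b.le

theorem gt_left (hf : IsExpandingLorenzOn f c a b) {x : ℝ} (hx : x ∈ Ioc c b) : a < f x := by
  obtain ⟨y, hcy, hyx⟩ := exists_between hx.1
  have hy : y ∈ Ioc c b := ⟨hcy, hyx.le.trans hx.2⟩
  refine lt_of_le_of_lt (hf.mapsTo ⟨?_, hy.2⟩).1 (hf.mono_right hy hx hyx)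
  exact hf.a_lt_c.le.trans hcy.le

theorem apply_left_lt_apply_right (hf : IsExpandingLorenzOn f c a b) : f a < f b := by
  obtain ⟨lam, hlam, hexp⟩ := hf.exists_expansion
  have hac := hf.a_lt_c
  have hcb := hf.c_lt_b
  have h1 : lam * (c - a) ≤ b - f a := by
    have ht : Tendsto (fun x => lam * (x - a)) (𝓝[<] c) (𝓝 (lam * (c - a))) :=
      ((continuous_id.sub continuous_const).const_mul lam).continuousWithinAt
    refine le_of_tendsto_of_tendsto ht (hf.lim_left.sub_const (f a)) ?_
    filter_upwards [Ioo_mem_nhdsLT hac] with x hx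
    exact hexp a x hx.1.le (Or.inl ⟨⟨le_rfl, hac⟩, hx.1.le, hx.2⟩)
  have h2 : lam * (b - c) ≤ f b - a := by
    have ht : Tendsto (fun x => lam * (b - x)) (𝓝[>] c) (𝓝 (lam * (b - c))) :=
      ((continuous_const.sub continuous_id).const_mul lam).continuousWithinAt
    refine le_of_tendsto_of_tendsto ht (hf.lim_right.const_sub (f b)) ?_
    filter_upwards [Ioo_mem_nhdsGT hcb] with x hx
    exact hexp x b hx.2.le (Or.inr ⟨⟨hx.1, hx.2.le⟩, hcb, le_rfl⟩)
  nlinarith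

theorem finite_preimage (hf : IsExpandingLorenzOn f c a b) {S : Set ℝ} (hS : S.Finite) :
    {x ∈ Icc a b | f x ∈ S}.Finite := by
  have h1 : (f ⁻¹' S ∩ Ico a c).Finite :=
    Set.Finite.of_finite_image (hS.subset (by rintro _ ⟨x, hx, rfl⟩; exact hx.1))
      (hf.mono_left.injOn.mono inter_subset_right)
  have h2 : (f ⁻¹' S ∩ Ioc c b).Finite :=
    Set.Finite.of_finite_image (hS.subset (by rintro _ ⟨x, hx, rfl⟩; exact hx.1))
      (hf.mono_right.injOn.mono inter_subset_right)
  refine ((h1.union h2).union (finite_singleton c)).subset ?_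
  rintro x ⟨hx, hxS⟩
  rcases lt_trichotomy x c with h | h | h
  · exact Or.inl (Or.inl ⟨hxS, hx.1, h⟩)
  · exact Or.inr h
  · exact Or.inl (Or.inr ⟨hxS, h, hx.2⟩)

theorem finite_hits (hf : IsExpandingLorenzOn f c a b) (m : ℕ) :
    {x ∈ Icc a b | f^[m] x = c}.Finite := by
  induction m with
  | zero => exact (finite_singleton c).subset fun x hx => hx.2
  | succ m ih =>
    refine (hf.finite_preimage ih).subset fun x hx => ⟨hx.1, hf.mapsTo hx.1, ?_⟩
    simpa using hx.2

/-- Near any interior point, all other points avoid the critical point for `m` steps. -/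
theorem eventually_iterate_ne (hf : IsExpandingLorenzOn f c a b) (m : ℕ) {p : ℝ}
    (hp : p ∈ Ioo a b) : ∀ᶠ x in 𝓝[≠] p, ∀ i < m, f^[i] x ≠ c := by
  have hfin : (⋃ i ∈ Iio m, {x ∈ Icc a b | f^[i] x = c}).Finite :=
    (finite_Iio m).biUnion fun i _ => hf.finite_hits i
  have h1 : (⋃ i ∈ Iio m, {x ∈ Icc a b | f^[i] x = c})ᶜ ∈ 𝓝[≠] p := by
    have := (hfin.subset (sdiff_subset (t := {p}))).isClosed.isOpen_compl.mem_nhds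
      (show p ∈ ((⋃ i ∈ Iio m, {x ∈ Icc a b | f^[i] x = c}) \ {p})ᶜ by simp)
    filter_upwards [mem_nhdsWithin_of_mem_nhds this, self_mem_nhdsWithin] with x hx hxp hxU
    exact hx ⟨hxU, hxp⟩
  filter_upwards [h1, mem_nhdsWithin_of_mem_nhds (Ioo_mem_nhds hp.1 hp.2)] with x hx hxI i hi h
  exact hx (mem_biUnion (show i ∈ Iio m from hi) ⟨Ioo_subset_Icc_self hxI, h⟩)

end IsExpandingLorenzOn

end Expansion

section Reflection

/-- The conjugate of `f` by the reflection `x ↦ 1 - x`. -/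
def lorenzReflect (f : ℝ → ℝ) (x : ℝ) : ℝ := 1 - f (1 - x)

theorem lorenzReflect_iterate (f : ℝ → ℝ) (m : ℕ) (x : ℝ) :
    (lorenzReflect f)^[m] x = 1 - f^[m] (1 - x) := by
  induction m generalizing x with
  | zero => simp
  | succ m ih => simp [ih, lorenzReflect]

theorem tendsto_one_sub_nhdsLT (c : ℝ) : Tendsto (fun x => 1 - x) (𝓝[<] (1 - c)) (𝓝[>] c) := by
  refine tendsto_nhdsWithin_iff.2 ⟨?_, ?_⟩
  · have : Tendsto (fun x : ℝ => 1 - x) (𝓝 (1 - c)) (𝓝 (1 - (1 - c))) :=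
      (continuous_const.sub continuous_id).tendsto _
    rw [sub_sub_cancel] at this
    exact this.mono_left nhdsWithin_le_nhds
  · filter_upwards [self_mem_nhdsWithin] with x hx
    have : x < 1 - c := hx
    exact lt_sub_comm.1 this

theorem tendsto_one_sub_nhdsGT (c : ℝ) : Tendsto (fun x => 1 - x) (𝓝[>] (1 - c)) (𝓝[<] c) := by
  refine tendsto_nhdsWithin_iff.2 ⟨?_, ?_⟩
  · have : Tendsto (fun x : ℝ => 1 - x) (𝓝 (1 - c)) (𝓝 (1 - (1 - c))) :=
      (continuous_const.sub continuous_id).tendsto _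
    rw [sub_sub_cancel] at this
    exact this.mono_left nhdsWithin_le_nhds
  · filter_upwards [self_mem_nhdsWithin] with x hx
    have : 1 - c < x := hx
    exact sub_lt_comm.1 this

theorem IsExpandingLorenzOn.reflect {f : ℝ → ℝ} {c a b : ℝ} (hf : IsExpandingLorenzOn f c a b) :
    IsExpandingLorenzOn (lorenzReflect f) (1 - c) (1 - b) (1 - a) where
  a_lt_c := by linarith [hf.c_lt_b]
  c_lt_b := by linarith [hf.a_lt_c]
  mapsTo := fun x hx => by
    have := hf.mapsTo (show 1 - x ∈ Icc a b from ⟨by linarith [hx.2], by linarith [hx.1]⟩)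
    exact ⟨by unfold lorenzReflect; linarith [this.2], by unfold lorenzReflect; linarith [this.1]⟩
  mono_left := fun x hx y hy hxy => by
    have := hf.mono_right (show 1 - y ∈ _ from ⟨by linarith [hy.2], by linarith [hy.1]⟩)
      (show 1 - x ∈ _ from ⟨by linarith [hx.2], by linarith [hx.1]⟩) (by linarith)
    unfold lorenzReflect; linarith
  mono_right := fun x hx y hy hxy => by
    have := hf.mono_left (show 1 - y ∈ _ from ⟨by linarith [hy.2], by linarith [hy.1]⟩)
      (show 1 - x ∈ _ from ⟨by linarith [hx.2], by linarith [hx.1]⟩) (by linarith)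
    unfold lorenzReflect; linarith
  cont_left := continuousOn_const.sub (hf.cont_right.comp
    (continuous_const.sub continuous_id).continuousOn
    fun x hx => ⟨by linarith [hx.2], by linarith [hx.1]⟩)
  cont_right := continuousOn_const.sub (hf.cont_left.comp
    (continuous_const.sub continuous_id).continuousOn
    fun x hx => ⟨by linarith [hx.2], by linarith [hx.1]⟩)
  lim_left := (hf.lim_right.comp (tendsto_one_sub_nhdsLT c)).const_sub 1
  lim_right := (hf.lim_left.comp (tendsto_one_sub_nhdsGT c)).const_sub 1
  expanding := by
    obtain ⟨F, hF, lam, hlam, hd⟩ := hf.expanding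
    refine ⟨(fun x => 1 - x) '' F, hF.image _, lam, hlam, fun x hx => ?_⟩
    obtain ⟨d, h1, h2⟩ := hd (1 - x) ⟨⟨by linarith [hx.1.2], by linarith [hx.1.1]⟩,
      fun h => hx.2 ⟨1 - x, h, by ring⟩⟩
    refine ⟨d, ?_, h2⟩
    have h3 : HasDerivWithinAt (fun x : ℝ => 1 - x) (-1) (Icc (1 - b) (1 - a)) x :=
      ((hasDerivAt_id x).const_sub 1).hasDerivWithinAt
    have h4 := h1.comp x h3 fun w hw => ⟨by linarith [hw.2], by linarith [hw.1]⟩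
    exact (h4.const_sub 1).congr_deriv (by ring)

theorem IsPrimaryCycle.reflect {f : ℝ → ℝ} {c : ℝ} {n k : ℕ} {z : ℕ → ℝ}
    (hz : IsPrimaryCycle f c n k z) :
    IsPrimaryCycle (lorenzReflect f) (1 - c) n (n - k) (fun i => 1 - z (n - 1 - i)) where
  k_pos := by have := hz.k_lt_n; omega
  k_lt_n := by have := hz.k_pos; have := hz.k_lt_n; omega
  coprime := by
    have := hz.coprime
    rwa [Nat.coprime_self_sub_right hz.k_lt_n.le]
  mem := fun i hi => by
    have := hz.mem (n - 1 - i) (by omega)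
    exact ⟨by linarith [this.2], by linarith [this.1]⟩
  mono := fun i j hij hj => by
    have := hz.mono (n - 1 - j) (n - 1 - i) (by omega) (by omega)
    linarith
  left_of_c := fun i hi => by
    have := hz.k_lt_n
    have := hz.right_of_c (n - 1 - i) (by omega) (by omega)
    linarith
  right_of_c := fun i hi hi' => by
    have := hz.k_lt_n
    have := hz.left_of_c (n - 1 - i) (by omega)
    linarith
  step := fun i hi => by
    have hk := hz.k_lt_n
    have h := hz.step (n - 1 - i) (by omega)
    simp only [lorenzReflect, sub_sub_cancel, h]
    congr 2
    rcases lt_or_ge i k with h | h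
    · rw [Nat.mod_eq_sub_mod (by omega), Nat.mod_eq_of_lt (by omega),
        Nat.mod_eq_of_lt (a := i + (n - k)) (by omega)]
      omega
    · rw [Nat.mod_eq_of_lt (by omega), Nat.mod_eq_sub_mod (a := i + (n - k)) (by omega),
        Nat.mod_eq_of_lt (a := i + (n - k) - n) (by omega)]
      omega
  le_f0 := by
    have := hz.k_lt_n
    have := hz.k_pos
    have h := hz.f1_le
    simp only [lorenzReflect, sub_zero]
    rw [show n - 1 - (n - k - 1) = k by omega]
    linarith
  f1_le := by
    have := hz.k_lt_n
    have := hz.k_pos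
    have h := hz.le_f0
    simp only [lorenzReflect, sub_self]
    rw [show n - 1 - (n - k) = k - 1 by omega]
    linarith

end Reflection

namespace IsPrimaryCycle

variable {f : ℝ → ℝ} {c : ℝ} {n k : ℕ} {z : ℕ → ℝ}

theorem iterate_apply (hz : IsPrimaryCycle f c n k z) (m : ℕ) {j : ℕ} (hj : j < n) :
    f^[m] (z j) = z ((j + m * k) % n) := by
  induction m with
  | zero => simp [Nat.mod_eq_of_lt hj]
  | succ m ih =>
    rw [iterate_succ_apply', ih, hz.step _ (Nat.mod_lt _ (by omega)), Nat.mod_add_mod]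
    congr 2
    ring

theorem iterate_ne (hz : IsPrimaryCycle f c n k z) (m : ℕ) {j : ℕ} (hj : j < n) :
    f^[m] (z j) ≠ c := by
  rw [hz.iterate_apply m hj]
  have hlt : (j + m * k) % n < n := Nat.mod_lt _ (by omega)
  rcases lt_or_ge ((j + m * k) % n) (n - k) with h | h
  · exact (hz.left_of_c _ h).ne
  · exact (hz.right_of_c _ h hlt).ne'

theorem le_of_index_le (hz : IsPrimaryCycle f c n k z) {i j : ℕ} (hij : i ≤ j) (hj : j < n) :
    z i ≤ z j := by
  rcases hij.eq_or_lt with rfl | h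
  · exact le_rfl
  · exact (hz.mono i j h hj).le

theorem mul_mod_ne (hz : IsPrimaryCycle f c n k z) {m : ℕ} (hm : 0 < m) (hmn : m < n) :
    (m * k) % n ≠ 0 := fun h =>
  absurd (Nat.le_of_dvd hm (hz.coprime.dvd_of_dvd_mul_right (Nat.dvd_of_mod_eq_zero h)))
    (by omega)

theorem mul_mod_ne_sub (hz : IsPrimaryCycle f c n k z) {m : ℕ} (hmn : m + 1 < n) :
    (m * k) % n ≠ n - k := fun h => by
  refine hz.mul_mod_ne m.succ_pos hmn ?_
  have := hz.k_lt_n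
  rw [Nat.succ_mul, ← Nat.mod_add_mod, h, Nat.sub_add_cancel (by omega), Nat.mod_self]

/-- The arcs into which the cycle cuts the circle obtained by gluing `0` to `1`. -/
def arc (z : ℕ → ℝ) (n j : ℕ) : Set ℝ :=
  if j = 0 then Ioo 0 (z 0) ∪ Ioo (z (n - 1)) 1 else Ioo (z (j - 1)) (z j)

theorem arc_of_pos {j : ℕ} (hj : 0 < j) : arc z n j = Ioo (z (j - 1)) (z j) := by
  rw [arc, if_neg hj.ne']

theorem eq_of_mem_arc (hz : IsPrimaryCycle f c n k z) {i j : ℕ} (hi : i < n) (hj : 0 < j)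
    (hjn : j < n) {x : ℝ} (hxi : x ∈ arc z n i) (hxj : x ∈ Ioo (z (j - 1)) (z j)) : i = j := by
  rcases Nat.eq_zero_or_pos i with rfl | hi0
  · rw [arc, if_pos rfl] at hxi
    rcases hxi with h | h
    · have := hz.le_of_index_le (i := 0) (j := j - 1) (by omega) (by omega)
      linarith [h.2, hxj.1]
    · have := hz.le_of_index_le (i := j) (j := n - 1) (by omega) (by omega)
      linarith [h.1, hxj.2]
  · rw [arc_of_pos hi0] at hxi
    rcases lt_trichotomy i j with h | h | h
    · have := hz.le_of_index_le (i := i) (j := j - 1) (by omega) (by omega)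
      linarith [hxi.2, hxj.1]
    · exact h
    · have := hz.le_of_index_le (i := j) (j := i - 1) (by omega) (by omega)
      linarith [hxj.2, hxi.1]

theorem arc_subset_or (hz : IsPrimaryCycle f c n k z)
    {j : ℕ} (hj : j < n) (hjk : j ≠ n - k) (hj0 : 0 < j) :
    Icc (z (j - 1)) (z j) ⊆ Ico 0 c ∨ Icc (z (j - 1)) (z j) ⊆ Ioc c 1 := by
  rcases lt_or_gt_of_ne hjk with h | h
  · exact Or.inl fun x hx => ⟨(hz.mem (j - 1) (by omega)).1.trans hx.1,
      hx.2.trans_lt (hz.left_of_c j h)⟩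
  · exact Or.inr fun x hx => ⟨(hz.right_of_c (j - 1) (by omega) (by omega)).trans_le hx.1,
      hx.2.trans (hz.mem j hj).2⟩

theorem apply_ends (hz : IsPrimaryCycle f c n k z)
    {j : ℕ} (hj : j < n) (hjk : j ≠ n - k) (hj0 : 0 < j) :
    0 < (j + k) % n ∧ f (z (j - 1)) = z ((j + k) % n - 1) ∧ f (z j) = z ((j + k) % n) := by
  have hk := hz.k_lt_n
  have hk0 := hz.k_pos
  rw [hz.step _ hj, hz.step (j - 1) (by omega)]
  rcases lt_or_gt_of_ne hjk with h | h
  · rw [Nat.mod_eq_of_lt (a := j + k) (by omega), Nat.mod_eq_of_lt (by omega)]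
    exact ⟨by omega, by congr 1; omega, rfl⟩
  · rw [Nat.mod_eq_sub_mod (a := j + k) (by omega), Nat.mod_eq_of_lt (a := j + k - n) (by omega),
      Nat.mod_eq_sub_mod (by omega), Nat.mod_eq_of_lt (by omega)]
    exact ⟨by omega, by congr 1; omega, rfl⟩

theorem strictMonoOn_arc (hf : IsExpandingLorenzOn f c 0 1) (hz : IsPrimaryCycle f c n k z)
    {j : ℕ} (hj : j < n) (hjk : j ≠ n - k) (hj0 : 0 < j) :
    StrictMonoOn f (Icc (z (j - 1)) (z j)) := by
  rcases arc_subset_or hz hj hjk hj0 with h | h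
  · exact hf.mono_left.mono h
  · exact hf.mono_right.mono h

theorem continuousOn_arc (hf : IsExpandingLorenzOn f c 0 1) (hz : IsPrimaryCycle f c n k z)
    {j : ℕ} (hj : j < n) (hjk : j ≠ n - k) (hj0 : 0 < j) :
    ContinuousOn f (Icc (z (j - 1)) (z j)) := by
  rcases arc_subset_or hz hj hjk hj0 with h | h
  · exact hf.cont_left.mono h
  · exact hf.cont_right.mono h

theorem apply_mem_arc (hf : IsExpandingLorenzOn f c 0 1) (hz : IsPrimaryCycle f c n k z)
    {j : ℕ} (hj : j < n) {x : ℝ} (hx : x ∈ arc z n j) (hxc : x ≠ c) :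
    f x ∈ arc z n ((j + k) % n) := by
  have hk := hz.k_lt_n
  have hk0 := hz.k_pos
  have hc0 := hf.a_lt_c
  have hc1 := hf.c_lt_b
  rcases Nat.eq_zero_or_pos j with rfl | hj0
  · rw [zero_add, Nat.mod_eq_of_lt hk, arc_of_pos hk0]
    rw [arc, if_pos rfl] at hx
    rcases hx with hx | hx
    · have h0 : z 0 < c := hz.left_of_c 0 (by omega)
      have hx' : x ∈ Ico 0 c := ⟨hx.1.le, hx.2.trans h0⟩
      have h1 := hf.mono_left ⟨le_rfl, hc0⟩ hx' hx.1
      have h2 := hf.mono_left hx' ⟨(hz.mem 0 hj).1, h0⟩ hx.2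
      rw [hz.step 0 hj, zero_add, Nat.mod_eq_of_lt hk] at h2
      exact ⟨hz.le_f0.trans_lt h1, h2⟩
    · have h0 : c < z (n - 1) := hz.right_of_c _ (by omega) (by omega)
      have hx' : x ∈ Ioc c 1 := ⟨h0.trans hx.1, hx.2.le⟩
      have h1 := hf.mono_right hx' ⟨hc1, le_rfl⟩ hx.2
      have h2 := hf.mono_right ⟨h0, (hz.mem (n - 1) (by omega)).2⟩ hx' hx.1
      rw [hz.step _ (by omega), Nat.mod_eq_sub_mod (by omega), Nat.mod_eq_of_lt (by omega),
        show n - 1 + k - n = k - 1 by omega] at h2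
      exact ⟨h2, h1.trans_le hz.f1_le⟩
  rw [arc_of_pos hj0] at hx
  by_cases hjk : j = n - k
  · subst hjk
    rw [Nat.sub_add_cancel hk.le, Nat.mod_self, arc, if_pos rfl]
    rcases lt_or_gt_of_ne hxc with h | h
    · right
      have hy := hz.mem (n - k - 1) (by omega)
      have hx' : x ∈ Ico 0 c := ⟨hy.1.trans hx.1.le, h⟩
      have h2 := hf.mono_left ⟨hy.1, hx.1.trans h⟩ hx' hx.1
      rw [hz.step _ (by omega), Nat.mod_eq_of_lt (by omega),
        show n - k - 1 + k = n - 1 by omega] at h2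
      exact ⟨h2, hf.lt_right hx'⟩
    · left
      have hy := hz.mem (n - k) (by omega)
      have hx' : x ∈ Ioc c 1 := ⟨h, hx.2.le.trans hy.2⟩
      have h2 := hf.mono_right hx' ⟨h.trans hx.2, hy.2⟩ hx.2
      rw [hz.step _ (by omega), Nat.sub_add_cancel hk.le, Nat.mod_self] at h2
      exact ⟨hf.gt_left hx', h2⟩
  · obtain ⟨h0, h1, h2⟩ := apply_ends hz hj hjk hj0
    have hm := strictMonoOn_arc hf hz hj hjk hj0
    have hlt := hx.1.trans hx.2
    have hx' := Ioo_subset_Icc_self hx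
    rw [arc_of_pos h0, ← h1, ← h2]
    exact ⟨hm (left_mem_Icc.2 hlt.le) hx' hx.1, hm hx' (right_mem_Icc.2 hlt.le) hx.2⟩

theorem iterate_mem_arc (hf : IsExpandingLorenzOn f c 0 1) (hz : IsPrimaryCycle f c n k z)
    {j m : ℕ} (hj : j < n) {x : ℝ} (hx : x ∈ arc z n j)
    (hxc : ∀ i < m, f^[i] x ≠ c) : f^[m] x ∈ arc z n ((j + m * k) % n) := by
  induction m with
  | zero => simpa [Nat.mod_eq_of_lt hj] using hx
  | succ m ih =>
    have := apply_mem_arc hf hz (Nat.mod_lt _ (by omega))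
      (ih fun i hi => hxc i (hi.trans m.lt_succ_self)) (hxc m m.lt_succ_self)
    rw [Nat.mod_add_mod] at this
    rw [iterate_succ_apply', Nat.succ_mul, ← add_assoc]
    exact this

/-- The iterates `f^[2], …, f^[n]` jump at `c` and their one-sided limits lie in one arc. -/
theorem exists_limits_mem_Icc (hf : IsExpandingLorenzOn f c 0 1) (hz : IsPrimaryCycle f c n k z)
    {m : ℕ} (hm : m + 1 < n) :
    0 < ((m + 1) * k) % n ∧ ∃ p q, p < q ∧
      p ∈ Icc (z (((m + 1) * k) % n - 1)) (z (((m + 1) * k) % n)) ∧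
      q ∈ Icc (z (((m + 1) * k) % n - 1)) (z (((m + 1) * k) % n)) ∧
      Tendsto f^[m + 2] (𝓝[>] c)
        (𝓝[Icc (z (((m + 1) * k) % n - 1)) (z (((m + 1) * k) % n))] p) ∧
      Tendsto f^[m + 2] (𝓝[<] c)
        (𝓝[Icc (z (((m + 1) * k) % n - 1)) (z (((m + 1) * k) % n))] q) := by
  have hk := hz.k_lt_n
  have hk0 := hz.k_pos
  have hc0 := hf.a_lt_c
  have hc1 := hf.c_lt_b
  induction m with
  | zero =>
    have h0 : z 0 < c := hz.left_of_c 0 (by omega)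
    have h0' : c < z (n - 1) := hz.right_of_c _ (by omega) (by omega)
    have e0 : f (z 0) = z k := by rw [hz.step 0 (by omega), zero_add, Nat.mod_eq_of_lt hk]
    have e1 : f (z (n - 1)) = z (k - 1) := by
      rw [hz.step _ (by omega), Nat.mod_eq_sub_mod (by omega), Nat.mod_eq_of_lt (by omega),
        show n - 1 + k - n = k - 1 by omega]
    have h01 := hf.apply_left_lt_apply_right
    simp only [zero_add, one_mul, Nat.mod_eq_of_lt hk]
    refine ⟨hk0, f 0, f 1, h01, ⟨hz.le_f0, h01.le.trans hz.f1_le⟩,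
      ⟨hz.le_f0.trans h01.le, hz.f1_le⟩, ?_, ?_⟩
    · have hz0 : 0 < z 0 := by
        have hy := hz.right_of_c (n - k) le_rfl (by omega)
        have := hf.gt_left ⟨hy, (hz.mem (n - k) (by omega)).2⟩
        rwa [hz.step _ (by omega), Nat.sub_add_cancel hk.le, Nat.mod_self] at this
      have t1 : Tendsto f (𝓝[>] c) (𝓝[Ico 0 (z 0)] 0) := by
        refine tendsto_nhdsWithin_iff.2 ⟨hf.lim_right, ?_⟩
        filter_upwards [hf.lim_right (Iio_mem_nhds hz0), Ioc_mem_nhdsGT hc1] with x hx hx'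
        exact ⟨(hf.gt_left hx').le, hx⟩
      have t2 : Tendsto f (𝓝[Ico 0 (z 0)] 0) (𝓝[Icc (z (k - 1)) (z k)] (f 0)) := by
        refine tendsto_nhdsWithin_iff.2
          ⟨(hf.cont_left 0 ⟨le_rfl, hc0⟩).mono (Ico_subset_Ico_right h0.le), ?_⟩
        filter_upwards [self_mem_nhdsWithin] with x hx
        have hx' : x ∈ Ico 0 c := ⟨hx.1, hx.2.trans h0⟩
        refine ⟨hz.le_f0.trans (hf.mono_left.monotoneOn ⟨le_rfl, hc0⟩ hx' hx.1), ?_⟩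
        rw [← e0]
        exact hf.mono_left.monotoneOn hx' ⟨hz0.le, h0⟩ hx.2.le
      exact t2.comp t1
    · have hz1 : z (n - 1) < 1 := by
        have hy := hz.left_of_c (n - k - 1) (by omega)
        have := hf.lt_right ⟨(hz.mem (n - k - 1) (by omega)).1, hy⟩
        rwa [hz.step _ (by omega), Nat.mod_eq_of_lt (by omega),
          show n - k - 1 + k = n - 1 by omega] at this
      have t1 : Tendsto f (𝓝[<] c) (𝓝[Ioc (z (n - 1)) 1] 1) := by
        refine tendsto_nhdsWithin_iff.2 ⟨hf.lim_left, ?_⟩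
        filter_upwards [hf.lim_left (Ioi_mem_nhds hz1), Ico_mem_nhdsLT hc0] with x hx hx'
        exact ⟨hx, (hf.lt_right hx').le⟩
      have t2 : Tendsto f (𝓝[Ioc (z (n - 1)) 1] 1) (𝓝[Icc (z (k - 1)) (z k)] (f 1)) := by
        refine tendsto_nhdsWithin_iff.2
          ⟨(hf.cont_right 1 ⟨hc1, le_rfl⟩).mono (Ioc_subset_Ioc_left h0'.le), ?_⟩
        filter_upwards [self_mem_nhdsWithin] with x hx
        have hx' : x ∈ Ioc c 1 := ⟨h0'.trans hx.1, hx.2⟩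
        refine ⟨?_, (hf.mono_right.monotoneOn hx' ⟨hc1, le_rfl⟩ hx.2).trans hz.f1_le⟩
        rw [← e1]
        exact hf.mono_right.monotoneOn ⟨h0', hz1.le⟩ hx' hx.1.le
      exact t2.comp t1
  | succ m ih =>
    obtain ⟨hj0, p, q, hpq, hp, hq, tp, tq⟩ := ih (by omega)
    have hj : ((m + 1) * k) % n < n := Nat.mod_lt _ (by omega)
    have hjk := hz.mul_mod_ne_sub (m := m + 1) (by omega)
    have hjs : ((m + 1 + 1) * k) % n = (((m + 1) * k) % n + k) % n := by
      rw [Nat.mod_add_mod, Nat.succ_mul]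
    rw [hjs]
    generalize ((m + 1) * k) % n = j at *
    obtain ⟨h0, h1, h2⟩ := apply_ends hz hj hjk hj0
    have hmono := strictMonoOn_arc hf hz hj hjk hj0
    have hcont := continuousOn_arc hf hz hj hjk hj0
    have hle : z (j - 1) ≤ z j := hp.1.trans hp.2
    have hmaps : MapsTo f (Icc (z (j - 1)) (z j)) (Icc (z ((j + k) % n - 1)) (z ((j + k) % n))) :=
      fun x hx => by
        rw [← h1, ← h2]
        exact ⟨hmono.monotoneOn (left_mem_Icc.2 hle) hx hx.1,
          hmono.monotoneOn hx (right_mem_Icc.2 hle) hx.2⟩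
    refine ⟨h0, f p, f q, hmono hp hq hpq, hmaps hp, hmaps hq, ?_, ?_⟩
    · rw [iterate_succ']
      exact ((hcont p hp).tendsto_nhdsWithin hmaps).comp tp
    · rw [iterate_succ']
      exact ((hcont q hq).tendsto_nhdsWithin hmaps).comp tq

theorem exists_limits (hf : IsExpandingLorenzOn f c 0 1) (hz : IsPrimaryCycle f c n k z)
    {s : ℕ} (hs0 : 0 < s) (hsn : s < n) :
    ∃ p q, p < q ∧ Tendsto f^[s] (𝓝[>] c) (𝓝 p) ∧ Tendsto f^[s] (𝓝[<] c) (𝓝 q) := by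
  obtain ⟨m, rfl⟩ | rfl : (∃ m, s = m + 2) ∨ s = 1 := by
    rcases Nat.lt_or_ge 1 s with h | h
    · exact Or.inl ⟨s - 2, by omega⟩
    · exact Or.inr (by omega)
  · obtain ⟨-, p, q, h, -, -, h1, h2⟩ := exists_limits_mem_Icc hf hz (m := m) (by omega)
    exact ⟨p, q, h, h1.mono_right nhdsWithin_le_nhds, h2.mono_right nhdsWithin_le_nhds⟩
  · exact ⟨0, 1, zero_lt_one, hf.lim_right, hf.lim_left⟩

/-- The iterates `f, …, f^[n]` are continuous, increasing and expanding on the right half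
`(c, z (n - k)]` of the central arc. -/
theorem iterate_rightHalf (hf : IsExpandingLorenzOn f c 0 1) (hz : IsPrimaryCycle f c n k z) :
    ∃ lam : ℝ, 1 < lam ∧ ∀ m < n,
    MapsTo f^[m + 1] (Ioc c (z (n - k)))
      (Ioc (if (m * k) % n = 0 then 0 else z ((m * k) % n - 1)) (z ((m * k) % n))) ∧
    StrictMonoOn f^[m + 1] (Ioc c (z (n - k))) ∧
    ContinuousOn f^[m + 1] (Ioc c (z (n - k))) ∧
    ∀ x ∈ Ioc c (z (n - k)), ∀ y ∈ Ioc c (z (n - k)), x ≤ y →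
      lam * (y - x) ≤ f^[m + 1] y - f^[m + 1] x := by
  have hk := hz.k_lt_n
  have hk0 := hz.k_pos
  have hc0 := hf.a_lt_c
  obtain ⟨lam, hlam, hexp⟩ := hf.exists_expansion
  refine ⟨lam, hlam, fun m => ?_⟩
  have hzc : c < z (n - k) := hz.right_of_c _ le_rfl (by omega)
  have hz1 := (hz.mem (n - k) (by omega)).2
  have hsub : Ioc c (z (n - k)) ⊆ Ioc c 1 := Ioc_subset_Ioc_right hz1
  induction m with
  | zero =>
    intro _
    simp only [zero_mul, Nat.zero_mod, zero_add, if_true, iterate_one]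
    refine ⟨fun x hx => ⟨hf.gt_left (hsub hx), ?_⟩, hf.mono_right.mono hsub,
      hf.cont_right.mono hsub, fun x hx y hy hxy => hexp x y hxy (Or.inr ⟨hsub hx, hsub hy⟩)⟩
    have := hf.mono_right.monotoneOn (hsub hx) ⟨hzc, hz1⟩ hx.2
    rwa [hz.step _ (by omega), Nat.sub_add_cancel hk.le, Nat.mod_self] at this
  | succ m ih =>
    intro hm
    obtain ⟨hmaps, hmono, hcont, hex⟩ := ih (by omega)
    have hj : (m * k) % n < n := Nat.mod_lt _ (by omega)
    have hjk := hz.mul_mod_ne_sub (m := m) (by omega)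
    have hj0' := hz.mul_mod_ne (m := m + 1) (by omega) hm
    have hjs : ((m + 1) * k) % n = ((m * k) % n + k) % n := by
      rw [Nat.mod_add_mod, Nat.succ_mul]
    rw [hjs] at hj0' ⊢
    generalize (m * k) % n = j at *
    rw [if_neg hj0']
    set lo := if j = 0 then 0 else z (j - 1) with hlo
    have hbranch : Ioc lo (z j) ⊆ Ico 0 c ∨ Ioc lo (z j) ⊆ Ioc c 1 := by
      rcases Nat.eq_zero_or_pos j with rfl | hj0
      · left
        intro x hx
        simp only [hlo, if_true] at hx
        exact ⟨hx.1.le, hx.2.trans_lt (hz.left_of_c 0 (by omega))⟩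
      · rw [hlo, if_neg hj0.ne']
        exact (arc_subset_or hz hj hjk hj0).imp Ioc_subset_Icc_self.trans
          Ioc_subset_Icc_self.trans
    have hfm : StrictMonoOn f (Ioc lo (z j)) :=
      hbranch.elim hf.mono_left.mono hf.mono_right.mono
    have hfc : ContinuousOn f (Ioc lo (z j)) :=
      hbranch.elim hf.cont_left.mono hf.cont_right.mono
    have hfmaps : MapsTo f (Ioc lo (z j)) (Ioc (z ((j + k) % n - 1)) (z ((j + k) % n))) := by
      intro x hx
      have hlt := hx.1.trans_le hx.2
      rcases Nat.eq_zero_or_pos j with rfl | hj0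
      · have e0 : f (z 0) = z k := by rw [hz.step 0 hj, zero_add, Nat.mod_eq_of_lt hk]
        simp only [hlo, if_true] at hx hlt
        rw [zero_add, Nat.mod_eq_of_lt hk, ← e0]
        have h0 : z 0 < c := hz.left_of_c 0 (by omega)
        have hx' : x ∈ Ico 0 c := ⟨hx.1.le, hx.2.trans_lt h0⟩
        exact ⟨hz.le_f0.trans_lt (hf.mono_left ⟨le_rfl, hc0⟩ hx' hx.1),
          hf.mono_left.monotoneOn hx' ⟨hlt.le, h0⟩ hx.2⟩
      · rw [hlo, if_neg hj0.ne'] at hx hlt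
        obtain ⟨-, h1, h2⟩ := apply_ends hz hj hjk hj0
        have hm := strictMonoOn_arc hf hz hj hjk hj0
        have hx' := Ioc_subset_Icc_self hx
        rw [← h1, ← h2]
        exact ⟨hm (left_mem_Icc.2 hlt.le) hx' hx.1,
          hm.monotoneOn hx' (right_mem_Icc.2 hlt.le) hx.2⟩
    rw [iterate_succ']
    refine ⟨hfmaps.comp hmaps, hfm.comp hmono hmaps, hfc.comp hcont hmaps, ?_⟩
    intro x hx y hy hxy
    have h1 := hex x hx y hy hxy
    have h2 := hexp _ _ (hmono.monotoneOn hx hy hxy)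
      (hbranch.imp (fun h => ⟨h (hmaps hx), h (hmaps hy)⟩) fun h => ⟨h (hmaps hx), h (hmaps hy)⟩)
    have h3 : 0 ≤ f^[m + 1] y - f^[m + 1] x := sub_nonneg.2 (hmono.monotoneOn hx hy hxy)
    simp only [comp_apply]
    nlinarith

theorem exists_preimage_critical (hf : IsExpandingLorenzOn f c 0 1) (hz : IsPrimaryCycle f c n k z)
    (q : ℕ) : ∃ d ∈ Ico c (z (n - k)), (0 < q → c < d) ∧
    Tendsto f^[q * n] (𝓝[>] d) (𝓝[>] c) ∧ Tendsto f^[q * n] (𝓝[<] d) (𝓝[<] c) := by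
  have hk := hz.k_lt_n
  have hk0 := hz.k_pos
  have hzc : c < z (n - k) := hz.right_of_c _ le_rfl (by omega)
  obtain ⟨lam, hlam, hret⟩ := iterate_rightHalf hf hz
  obtain ⟨-, hmono, hcont, hexp⟩ := hret (n - 1) (by omega)
  rw [Nat.sub_add_cancel (by omega)] at hmono hcont hexp
  have hfix : f^[n] (z (n - k)) = z (n - k) := by
    rw [hz.iterate_apply n (by omega), Nat.add_mul_mod_self_left, Nat.mod_eq_of_lt (by omega)]
  obtain ⟨a, hca, haz, hfa⟩ : ∃ a, c < a ∧ a < z (n - k) ∧ f^[n] a < c := by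
    have h1 : 0 < (lam - 1) * (z (n - k) - c) := mul_pos (by linarith) (by linarith)
    refine ⟨c + (lam - 1) * (z (n - k) - c) / (2 * lam), ?_⟩
    have h2 : 0 < (lam - 1) * (z (n - k) - c) / (2 * lam) := div_pos h1 (by linarith)
    have h3 : lam * ((lam - 1) * (z (n - k) - c) / (2 * lam)) =
        (lam - 1) * (z (n - k) - c) / 2 := by
      field_simp
    set e := (lam - 1) * (z (n - k) - c) / (2 * lam)
    have h4 : c + e < z (n - k) := by nlinarith
    refine ⟨by linarith, h4, ?_⟩
    have := hexp (c + e) ⟨by linarith, h4.le⟩ (z (n - k)) ⟨hzc, le_rfl⟩ h4.le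
    rw [hfix] at this
    nlinarith
  induction q with
  | zero => exact ⟨c, ⟨le_rfl, hzc⟩, by simp, by simpa using tendsto_id, by simpa using tendsto_id⟩
  | succ q ih =>
    obtain ⟨d, hd, -, h1, h2⟩ := ih
    have hsub : Icc a (z (n - k)) ⊆ Ioc c (z (n - k)) :=
      fun x hx => ⟨hca.trans_le hx.1, hx.2⟩
    obtain ⟨e, he, hed⟩ := intermediate_value_Icc haz.le (hcont.mono hsub)
      (show d ∈ Icc _ _ from ⟨hfa.le.trans hd.1, hfix.symm ▸ hd.2.le⟩)
    have hez : e < z (n - k) := lt_of_le_of_ne he.2 fun h => by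
      rw [h, hfix] at hed
      exact hd.2.ne hed.symm
    have hce := hca.trans_le he.1
    have hec : Tendsto f^[n] (𝓝 e) (𝓝 d) := by
      have := hcont.continuousAt (Ioc_mem_nhds hce hez)
      rwa [ContinuousAt, hed] at this
    refine ⟨e, ⟨hce.le, hez⟩, fun _ => hce, ?_, ?_⟩
    · rw [Nat.succ_mul, iterate_add]
      refine h1.comp (tendsto_nhdsWithin_iff.2 ⟨hec.mono_left nhdsWithin_le_nhds, ?_⟩)
      filter_upwards [Ioo_mem_nhdsGT hez] with x hx
      rw [← hed]
      exact hmono ⟨hce, hez.le⟩ ⟨hce.trans hx.1, hx.2.le⟩ hx.1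
    · rw [Nat.succ_mul, iterate_add]
      refine h2.comp (tendsto_nhdsWithin_iff.2 ⟨hec.mono_left nhdsWithin_le_nhds, ?_⟩)
      filter_upwards [Ioo_mem_nhdsLT hce] with x hx
      rw [← hed]
      exact hmono ⟨hx.1, hx.2.le.trans hez.le⟩ ⟨hce, hez.le⟩ hx.2

variable {g : ℝ → ℝ} {u v : ℝ} {l r : ℕ}

theorem dvd_of_le (hf : IsExpandingLorenzOn f c 0 1) (hz : IsPrimaryCycle f c n k z)
    (hg : IsExpandingLorenzOn g c u v)
    (hl : ∀ x ∈ Ico u c, (∀ i < l, f^[i] x ≠ c) → g x = f^[l] x) (hvz : v ≤ z (n - k)) :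
    n ∣ l := by
  have hk := hz.k_lt_n
  have hk0 := hz.k_pos
  have hy : z (n - k - 1) < c := hz.left_of_c _ (by omega)
  have hzc : c < z (n - k) := hz.right_of_c _ le_rfl (by omega)
  have hgen : ∀ᶠ x in 𝓝[<] c, ∀ i < l, f^[i] x ≠ c :=
    (hf.eventually_iterate_ne l ⟨hf.a_lt_c, hf.c_lt_b⟩).filter_mono
      (nhdsWithin_mono c fun x (hx : x < c) => hx.ne)
  obtain ⟨x, ⟨⟨hxc, hxu⟩, hxy⟩, hgx⟩ := (((hgen.and (Ico_mem_nhdsLT hg.a_lt_c)).and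
    (Ioo_mem_nhdsLT hy)).and (hg.lim_left (Ioi_mem_nhds (hy.trans hg.c_lt_b)))).exists
  have hlt := hg.lt_right hxu
  have hgx' : z (n - k - 1) < g x := hgx
  rw [hl x hxu hxc] at hlt hgx'
  have hmem := iterate_mem_arc hf hz (j := n - k) (m := l) (x := x) (by omega)
    (by rw [arc_of_pos (by omega)]; exact ⟨hxy.1, hxy.2.trans hzc⟩) hxc
  have heq := hz.eq_of_mem_arc (Nat.mod_lt _ (by omega)) (by omega) (by omega) hmem
    ⟨hgx', hlt.trans_le hvz⟩
  have hmod : n - k + l * k ≡ n - k + 0 [MOD n] := by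
    rw [Nat.ModEq, heq, add_zero, Nat.mod_eq_of_lt (by omega)]
  exact hz.coprime.dvd_of_dvd_mul_right
    ((Nat.modEq_zero_iff_dvd).1 (Nat.ModEq.add_left_cancel' _ hmod))

theorem not_dvd_and_lt_of_lt (hf : IsExpandingLorenzOn f c 0 1) (hz : IsPrimaryCycle f c n k z)
    (hg : IsExpandingLorenzOn g c u v) (hv : v ≤ 1)
    (hr : ∀ x ∈ Ioc c v, (∀ i < r, f^[i] x ≠ c) → g x = f^[r] x) (hzv : z (n - k) < v) :
    ¬ n ∣ r ∧ r < n := by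
  have hk := hz.k_lt_n
  have hk0 := hz.k_pos
  have hzc : c < z (n - k) := hz.right_of_c _ le_rfl (by omega)
  have hnd : ¬ n ∣ r := by
    rintro ⟨m, rfl⟩
    have hfix := hr (z (n - k)) ⟨hzc, hzv.le⟩ fun i _ => hz.iterate_ne i (by omega)
    rw [hz.iterate_apply _ (by omega), mul_assoc, Nat.add_mul_mod_self_left,
      Nat.mod_eq_of_lt (by omega)] at hfix
    obtain ⟨lam, hlam, hexp⟩ := hg.exists_expansion
    have h1 := hexp _ v hzv.le (Or.inr ⟨⟨hzc, hzv.le⟩, hg.c_lt_b, le_rfl⟩)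
    have h2 := (hg.mapsTo (right_mem_Icc.2 (hg.a_lt_c.trans hg.c_lt_b).le)).2
    rw [hfix] at h1
    nlinarith
  refine ⟨hnd, lt_of_not_ge fun hnr => ?_⟩
  have hs0 : 0 < r % n := Nat.pos_of_ne_zero fun h => hnd (Nat.dvd_of_mod_eq_zero h)
  obtain ⟨p, q, hpq, hp, hq⟩ := exists_limits hf hz hs0 (Nat.mod_lt r (by omega))
  obtain ⟨d, hd, hcd, hdr, hdl⟩ := exists_preimage_critical hf hz (r / n)
  replace hcd := hcd (Nat.div_pos hnr (by omega))
  have hdv := hd.2.trans hzv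
  have hdec : f^[r] = f^[r % n] ∘ f^[r / n * n] := by
    rw [← iterate_add, Nat.mul_comm, Nat.mod_add_div]
  have hgen := hf.eventually_iterate_ne r (p := d) ⟨hf.a_lt_c.trans hcd, hdv.trans_le hv⟩
  have heq : ∀ᶠ x in 𝓝[≠] d, f^[r] x = g x := by
    filter_upwards [hgen, mem_nhdsWithin_of_mem_nhds (Ioc_mem_nhds hcd hdv)] with x hx hxI
    exact (hr x hxI hx).symm
  have hgd : Tendsto g (𝓝 d) (𝓝 (g d)) := hg.cont_right.continuousAt (Ioc_mem_nhds hcd hdv)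
  have hfd : Tendsto f^[r] (𝓝[≠] d) (𝓝 (g d)) :=
    (hgd.mono_left nhdsWithin_le_nhds).congr' (heq.mono fun x hx => hx.symm)
  have hpd : p = g d := by
    refine tendsto_nhds_unique (hp.comp hdr) ?_
    rw [← hdec]
    exact hfd.mono_left (nhdsWithin_mono d fun x (hx : d < x) => hx.ne')
  have hqd : q = g d := by
    refine tendsto_nhds_unique (hq.comp hdl) ?_
    rw [← hdec]
    exact hfd.mono_left (nhdsWithin_mono d fun x (hx : x < d) => hx.ne)
  exact hpq.ne (hpd.trans hqd.symm)

end IsPrimaryCycle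

/-- if `f` has a primary `n(k)`-cycle and `(f^l, f^r)` is a
renormalization of `f` with `l ≥ n` or `r ≥ n`, then `n ∣ l` and `n ∣ r`. -/
theorem primary_cycle_renormalization_divisibility
    (f g : ℝ → ℝ) (c : ℝ) (n k l r : ℕ) (z : ℕ → ℝ) (u v : ℝ)
    (hf : IsExpandingLorenz f c) (hz : IsPrimaryCycle f c n k z)
    (hg : IsRenormalization f c l r u v g) (h : n ≤ l ∨ n ≤ r) :
    n ∣ l ∧ n ∣ r := by
  have hk := hz.k_lt_n
  have hk0 := hz.k_pos
  have hf' := IsExpandingLorenzOn.reflect hf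
  rw [sub_self, sub_zero] at hf'
  have hz' := hz.reflect
  have hg' := hg.lorenz.reflect
  have hl' : ∀ x ∈ Ioc (1 - c) (1 - u), (∀ i < l, (lorenzReflect f)^[i] x ≠ 1 - c) →
      lorenzReflect g x = (lorenzReflect f)^[l] x := fun x hx hi => by
    rw [lorenzReflect_iterate, lorenzReflect,
      hg.eq_left (1 - x) ⟨by linarith [hx.2], by linarith [hx.1]⟩ fun i hil h =>
        hi i hil (by rw [lorenzReflect_iterate, h])]
  have hr' : ∀ x ∈ Ico (1 - v) (1 - c), (∀ i < r, (lorenzReflect f)^[i] x ≠ 1 - c) →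
      lorenzReflect g x = (lorenzReflect f)^[r] x := fun x hx hi => by
    rw [lorenzReflect_iterate, lorenzReflect,
      hg.eq_right (1 - x) ⟨by linarith [hx.2], by linarith [hx.1]⟩ fun i hil h =>
        hi i hil (by rw [lorenzReflect_iterate, h])]
  have hidx : n - 1 - (n - (n - k)) = n - k - 1 := by omega
  rcases le_or_gt v (z (n - k)) with hv | hv
  · have hl := IsPrimaryCycle.dvd_of_le hf hz hg.lorenz hg.eq_left hv
    refine ⟨hl, IsPrimaryCycle.dvd_of_le hf' hz' hg' hr' ?_⟩
    by_contra! hu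
    exact (IsPrimaryCycle.not_dvd_and_lt_of_lt hf' hz' hg' (by linarith [hg.u_nonneg]) hl' hu).1 hl
  · obtain ⟨hr, hrn⟩ := IsPrimaryCycle.not_dvd_and_lt_of_lt hf hz hg.lorenz hg.v_le_one
      hg.eq_right hv
    have hu : 1 - z (n - 1 - (n - (n - k))) < 1 - u := by
      by_contra! hu
      exact hr (IsPrimaryCycle.dvd_of_le hf' hz' hg' hr' hu)
    have := (IsPrimaryCycle.not_dvd_and_lt_of_lt hf' hz' hg' (by linarith [hg.u_nonneg]) hl' hu).2
    omega
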